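/- Let g = (g₁,…,g_n) be independent standard Gaussian random variables and let h₁,…,h_n : ℝⁿ → ℝ be twice continuously differentiable functions of g such that h_j and its first and second partial derivatives are square-integrable with respect to the n-dimensional standard Gaussian measure. Then E( Σ_{j=1}^n g_j h_j - Σ_{j=1}^n ∂h_j/∂g_j )² = Σ_{j=1}^n E h_j² + Σ_{j,k=1}^n E( (∂h_j/∂g_k)(∂h_k/∂g_j) ). -/

import Mathlib

open MeasureTheory ProbabilityTheory Real Finset

namespace SK

/-- Index set of pairs `i < j` in `Fin N`. -/
abbrev Pairs (N : ℕ) := {p : Fin N × Fin N // p.1 < p.2}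

/-- The disorder: one real coordinate per pair. -/
abbrev Disorder (N : ℕ) := Pairs N → ℝ

/-- Law of the disorder: i.i.d. standard Gaussians. -/
noncomputable def μdis (N : ℕ) : Measure (Disorder N) :=
  Measure.pi fun _ => gaussianReal 0 1

/-- The symmetric extension `g_{ij}` of the disorder. -/
noncomputable def gval {N : ℕ} (G : Disorder N) (i j : Fin N) : ℝ :=
  if hij : i < j then G ⟨(i, j), hij⟩ else if hji : j < i then G ⟨(j, i), hji⟩ else 0

abbrev Config (N : ℕ) := Fin N → Bool

/-- Spins `±1`. -/
def spin (b : Bool) : ℝ := if b then 1 else -1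

/-- (Negative) Hamiltonian of the SK model. -/
noncomputable def ham {N : ℕ} (β h : ℝ) (G : Disorder N) (σ : Config N) : ℝ :=
  (β / Real.sqrt N) * ∑ p : Pairs N, G p * spin (σ p.1.1) * spin (σ p.1.2)
    + h * ∑ i, spin (σ i)

/-- Partition function. -/
noncomputable def Zpart {N : ℕ} (β h : ℝ) (G : Disorder N) : ℝ :=
  ∑ σ : Config N, Real.exp (ham β h G σ)

/-- Gibbs measure. -/
noncomputable def gibbs {N : ℕ} (β h : ℝ) (G : Disorder N) (σ : Config N) : ℝ :=
  Real.exp (ham β h G σ) / Zpart β h G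

/-- Quenched average of a function of one replica. -/
noncomputable def qavg {N : ℕ} (β h : ℝ) (G : Disorder N) (f : Config N → ℝ) : ℝ :=
  ∑ σ : Config N, f σ * gibbs β h G σ

/-- Quenched average of a function of two replicas. -/
noncomputable def qavg2 {N : ℕ} (β h : ℝ) (G : Disorder N)
    (f : Config N → Config N → ℝ) : ℝ :=
  ∑ σ1 : Config N, ∑ σ2 : Config N, f σ1 σ2 * gibbs β h G σ1 * gibbs β h G σ2

/-- Overlap of two configurations. -/
noncomputable def overlap {N : ℕ} (σ1 σ2 : Config N) : ℝ :=
  (1 / (N : ℝ)) * ∑ i, spin (σ1 i) * spin (σ2 i)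

/-- The high temperature condition `E⟨(R₁₂ - q)⁴⟩ ≤ K/N²`. -/
def highTemp (N : ℕ) (β h q K : ℝ) : Prop :=
  ∫ G, qavg2 β h G (fun σ1 σ2 => (overlap σ1 σ2 - q) ^ 4) ∂(μdis N) ≤ K / (N : ℝ) ^ 2

/-- Magnetization `⟨σ_i⟩`. -/
noncomputable def mavg {N : ℕ} (β h : ℝ) (G : Disorder N) (i : Fin N) : ℝ :=
  qavg β h G fun σ => spin (σ i)

/-- Local field `ℓ_i`. -/
noncomputable def locField {N : ℕ} (G : Disorder N) (i : Fin N) (σ : Config N) : ℝ :=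
  (1 / Real.sqrt N) * ∑ j ∈ Finset.univ.erase i, gval G i j * spin (σ j)

/-- The field `r_i`. -/
noncomputable def rfield {N : ℕ} (β h q : ℝ) (G : Disorder N) (i : Fin N) : ℝ :=
  (1 / Real.sqrt N) * ∑ j ∈ Finset.univ.erase i, gval G i j * mavg β h G j
    - β * (1 - q) * mavg β h G i

/-- Gaussian density `φ_{μ,v}` with mean `μ` and variance `v`. -/
noncomputable def gaussDens (μ v x : ℝ) : ℝ :=
  (1 / (Real.sqrt (2 * π) * Real.sqrt v)) * Real.exp (-(x - μ) ^ 2 / (2 * v))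

/-- Mixture-Gaussian density `ψ_{a,b,μ,v}`. -/
noncomputable def mixDens (a b μ v x : ℝ) : ℝ :=
  Real.cosh (a * x + b) * Real.exp (-(x - μ) ^ 2 / (2 * v)) /
    (Real.sqrt (2 * π) * Real.sqrt v * Real.cosh (a * μ + b) * Real.exp (a ^ 2 * v / 2))


/-- `∂f/∂x_k`, the partial derivative of `f : ℝⁿ → ℝ` in the `k`-th coordinate. -/
noncomputable def pd {n : ℕ} (f : (Fin n → ℝ) → ℝ) (k : Fin n)
    (x : Fin n → ℝ) : ℝ :=
  fderiv ℝ f x (Pi.single k 1)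

/-- The law of `n` i.i.d. standard Gaussians. -/
noncomputable abbrev gaussianPi (n : ℕ) : Measure (Fin n → ℝ) :=
  Measure.pi fun _ => gaussianReal 0 1

/-- The Lebesgue density of `gaussianPi n`. -/
noncomputable def gaussianPiDensity (n : ℕ) (x : Fin n → ℝ) : ℝ :=
  ∏ i, gaussianPDFReal 0 1 (x i)

lemma gaussianPiDensity_nonneg (n : ℕ) (x : Fin n → ℝ) : 0 ≤ gaussianPiDensity n x :=
  Finset.prod_nonneg fun i _ => gaussianPDFReal_nonneg 0 1 (x i)

lemma measurable_gaussianPiDensity (n : ℕ) : Measurable (gaussianPiDensity n) := by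
  unfold gaussianPiDensity
  exact Finset.measurable_prod _ fun i _ =>
    (measurable_gaussianPDFReal 0 1).comp (measurable_pi_apply i)

lemma gaussianPi_eq_withDensity (n : ℕ) :
    gaussianPi n = volume.withDensity fun x => ENNReal.ofReal (gaussianPiDensity n x) := by
  refine Measure.pi_eq fun s hs => ?_
  have hint : ∀ i, Integrable ((s i).indicator (gaussianPDFReal 0 1)) :=
    fun i => (integrable_gaussianPDFReal 0 1).indicator (hs i)
  have hnonneg : ∀ i t, 0 ≤ (s i).indicator (gaussianPDFReal 0 1) t :=
    fun i t => Set.indicator_nonneg (fun t _ => gaussianPDFReal_nonneg 0 1 t) t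
  have hind : ∀ x : Fin n → ℝ,
      (Set.univ.pi s).indicator (fun x => ENNReal.ofReal (gaussianPiDensity n x)) x
        = ENNReal.ofReal (∏ i, (s i).indicator (gaussianPDFReal 0 1) (x i)) := by
    intro x
    by_cases hx : x ∈ Set.univ.pi s
    · rw [Set.indicator_of_mem hx, gaussianPiDensity]
      congr 1
      exact Finset.prod_congr rfl fun i _ =>
        (Set.indicator_of_mem (hx i (Set.mem_univ i)) _).symm
    · rw [Set.indicator_of_notMem hx]
      obtain ⟨i, hi⟩ : ∃ i, x i ∉ s i := by simpa [Set.mem_pi] using hx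
      rw [Finset.prod_eq_zero (Finset.mem_univ i) (Set.indicator_of_notMem hi _),
        ENNReal.ofReal_zero]
  rw [withDensity_apply _ (MeasurableSet.univ_pi hs),
    ← lintegral_indicator (MeasurableSet.univ_pi hs)]
  simp_rw [hind]
  rw [← ofReal_integral_eq_lintegral_ofReal, integral_fintype_prod_volume_eq_prod,
    ENNReal.ofReal_prod_of_nonneg fun i _ => integral_nonneg (hnonneg i)]
  · refine Finset.prod_congr rfl fun i _ => ?_
    rw [gaussianReal_apply_eq_integral 0 one_ne_zero, integral_indicator (hs i)]
  · exact Integrable.fintype_prod hint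
  · exact ae_of_all _ fun x => Finset.prod_nonneg fun i _ => hnonneg i (x i)

lemma integrable_gaussianPi_iff {n : ℕ} {f : (Fin n → ℝ) → ℝ} :
    Integrable f (gaussianPi n) ↔ Integrable fun x => f x * gaussianPiDensity n x := by
  rw [gaussianPi_eq_withDensity, integrable_withDensity_iff
    (measurable_gaussianPiDensity n).ennreal_ofReal (ae_of_all _ fun x => ENNReal.ofReal_lt_top)]
  simp_rw [ENNReal.toReal_ofReal (gaussianPiDensity_nonneg n _)]

lemma integral_gaussianPi {n : ℕ} (f : (Fin n → ℝ) → ℝ) :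
    ∫ x, f x ∂(gaussianPi n) = ∫ x, f x * gaussianPiDensity n x := by
  rw [gaussianPi_eq_withDensity, integral_withDensity_eq_integral_toReal_smul
    (measurable_gaussianPiDensity n).ennreal_ofReal (ae_of_all _ fun x => ENNReal.ofReal_lt_top)]
  simp_rw [ENNReal.toReal_ofReal (gaussianPiDensity_nonneg n _), smul_eq_mul, mul_comm]

lemma hasDerivAt_gaussianPDFReal (t : ℝ) :
    HasDerivAt (gaussianPDFReal 0 1) (-t * gaussianPDFReal 0 1 t) t := by
  have h : HasDerivAt (fun x : ℝ => -(x - 0) ^ 2 / (2 * ((1 : NNReal) : ℝ))) (-t) t := by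
    have := (((hasDerivAt_id t).sub_const 0).pow 2).neg.div_const (2 * ((1 : NNReal) : ℝ))
    refine this.congr_deriv ?_
    simp
    ring
  have := h.exp.const_mul (√(2 * π * ((1 : NNReal) : ℝ)))⁻¹
  rw [gaussianPDFReal_def]
  refine this.congr_deriv ?_
  ring

lemma hasFDerivAt_comp_apply {n : ℕ} {q : ℝ → ℝ} {q' : ℝ} (k : Fin n) (x : Fin n → ℝ)
    (hq : HasDerivAt q q' (x k)) :
    HasFDerivAt (fun y : Fin n → ℝ => q (y k))
      (q' • (ContinuousLinearMap.proj k : (Fin n → ℝ) →L[ℝ] ℝ)) x := by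
  have hp : HasFDerivAt (fun y : Fin n → ℝ => y k)
      (ContinuousLinearMap.proj k : (Fin n → ℝ) →L[ℝ] ℝ) x := hasFDerivAt_apply k x
  exact hq.comp_hasFDerivAt x hp

lemma hasFDerivAt_gaussianPiDensity {n : ℕ} (x : Fin n → ℝ) :
    HasFDerivAt (gaussianPiDensity n) (∑ i,
      (∏ j ∈ Finset.univ.erase i, gaussianPDFReal 0 1 (x j)) •
      (-x i * gaussianPDFReal 0 1 (x i)) •
        (ContinuousLinearMap.proj i : (Fin n → ℝ) →L[ℝ] ℝ)) x :=
  HasFDerivAt.finsetProd (u := Finset.univ)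
    fun i _ => hasFDerivAt_comp_apply i x (hasDerivAt_gaussianPDFReal (x i))

lemma pd_gaussianPiDensity {n : ℕ} (k : Fin n) (x : Fin n → ℝ) :
    pd (gaussianPiDensity n) k x = -x k * gaussianPiDensity n x := by
  rw [pd, (hasFDerivAt_gaussianPiDensity x).fderiv]
  simp only [FunLike.coe_sum, Finset.sum_apply, FunLike.coe_smul, Pi.smul_apply,
    ContinuousLinearMap.proj_apply, smul_eq_mul]
  rw [Finset.sum_eq_single k]
  · rw [gaussianPiDensity, ← Finset.mul_prod_erase _ _ (Finset.mem_univ k)]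
    simp
    ring
  · intro i _ hi
    simp [Pi.single_eq_of_ne hi]
  · simp

lemma continuous_pd {n : ℕ} {f : (Fin n → ℝ) → ℝ} (hf : ContDiff ℝ 1 f) (k : Fin n) :
    Continuous (pd f k) :=
  (hf.continuous_fderiv one_ne_zero).clm_apply continuous_const

lemma contDiff_pd {n : ℕ} {f : (Fin n → ℝ) → ℝ} (hf : ContDiff ℝ 2 f) (k : Fin n) :
    ContDiff ℝ 1 (pd f k) :=
  (hf.fderiv_right (m := 1) (by norm_num)).clm_apply contDiff_const

lemma pd_mul {n : ℕ} {f g : (Fin n → ℝ) → ℝ} (hf : Differentiable ℝ f) (hg : Differentiable ℝ g)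
    (k : Fin n) (x : Fin n → ℝ) :
    pd (fun y => f y * g y) k x = pd f k x * g x + f x * pd g k x := by
  rw [pd, fderiv_fun_mul (hf x) (hg x)]
  simp only [pd, FunLike.coe_add, FunLike.coe_smul, Pi.add_apply, Pi.smul_apply, smul_eq_mul]
  ring

lemma pd_sub {n : ℕ} {f g : (Fin n → ℝ) → ℝ} (hf : Differentiable ℝ f) (hg : Differentiable ℝ g)
    (k : Fin n) (x : Fin n → ℝ) :
    pd (fun y => f y - g y) k x = pd f k x - pd g k x := by
  rw [pd, fderiv_fun_sub (hf x) (hg x)]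
  rfl

lemma pd_comp_apply {n : ℕ} {q : ℝ → ℝ} {q' : ℝ} (k j : Fin n) (x : Fin n → ℝ)
    (hq : HasDerivAt q q' (x k)) :
    pd (fun y => q (y k)) j x = if k = j then q' else 0 := by
  rw [pd, (hasFDerivAt_comp_apply k x hq).fderiv]
  simp [Pi.single_apply]

lemma pd_pd_comm {n : ℕ} {f : (Fin n → ℝ) → ℝ} (hf : ContDiff ℝ 2 f) (j k : Fin n)
    (x : Fin n → ℝ) : pd (pd f j) k x = pd (pd f k) j x := by
  have hd : DifferentiableAt ℝ (fderiv ℝ f) x :=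
    (hf.fderiv_right (m := 1) (by norm_num)).differentiable one_ne_zero x
  have key : ∀ v w : Fin n → ℝ,
      fderiv ℝ (fun y => fderiv ℝ f y v) x w = fderiv ℝ (fderiv ℝ f) x w v := by
    intro v w
    rw [fderiv_clm_apply hd (differentiableAt_const v)]
    simp
  have hsymm := (hf.contDiffAt (x := x)).isSymmSndFDerivAt (by simp)
  exact (key _ _).trans ((hsymm _ _).trans (key _ _).symm)

/-- Gaussian integration by parts. -/
lemma integral_mul_gaussianPi_eq_integral_pd {n : ℕ} {F : (Fin n → ℝ) → ℝ} (k : Fin n)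
    (hF : Differentiable ℝ F) (hi : Integrable F (gaussianPi n))
    (hi' : Integrable (pd F k) (gaussianPi n))
    (hxi : Integrable (fun x => x k * F x) (gaussianPi n)) :
    ∫ x, x k * F x ∂(gaussianPi n) = ∫ x, pd F k x ∂(gaussianPi n) := by
  have hpd : ∀ x, F x * fderiv ℝ (gaussianPiDensity n) x (Pi.single k 1)
      = -(x k * F x * gaussianPiDensity n x) := fun x => by
    rw [← pd, pd_gaussianPiDensity]
    ring
  rw [integrable_gaussianPi_iff] at hi hi' hxi
  have h := integral_mul_fderiv_eq_neg_fderiv_mul_of_integrable hi'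
    (by simp_rw [hpd]; exact hxi.neg) hi (fun x _ => hF x)
    (fun x _ => (hasFDerivAt_gaussianPiDensity x).differentiableAt)
  simp_rw [hpd, integral_neg, neg_inj] at h
  rw [integral_gaussianPi, integral_gaussianPi]
  exact h

lemma hasDerivAt_div_one_add_mul_sq {ε : ℝ} (hε : 0 < ε) (t : ℝ) :
    HasDerivAt (fun t : ℝ => t / (1 + ε * t ^ 2))
      ((1 - ε * t ^ 2) / (1 + ε * t ^ 2) ^ 2) t := by
  have hpos : 1 + ε * t ^ 2 ≠ 0 := by positivity
  have := (hasDerivAt_id t).fun_div (((hasDerivAt_id t).pow 2).const_mul ε |>.const_add 1) hpos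
  refine this.congr_deriv ?_
  simp
  ring

lemma continuous_div_one_add_mul_sq {ε : ℝ} (hε : 0 < ε) :
    Continuous fun t : ℝ => t / (1 + ε * t ^ 2) :=
  continuous_iff_continuousAt.2 fun t => (hasDerivAt_div_one_add_mul_sq hε t).continuousAt

/-- Uniform bound for the truncations `x k ^ 2 / (1 + ε * x k ^ 2)` of `x k ^ 2`. -/
lemma integral_truncated_sq_mul_sq_le {n : ℕ} {f : (Fin n → ℝ) → ℝ} (k : Fin n)
    (hf : ContDiff ℝ 1 f) (hf2 : MemLp f 2 (gaussianPi n))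
    (hf2' : MemLp (pd f k) 2 (gaussianPi n)) {ε : ℝ} (hε : 0 < ε) (hε1 : ε ≤ 1) :
    Integrable (fun x => x k * (f x * f x * (x k / (1 + ε * x k ^ 2)))) (gaussianPi n) ∧
    ∫ x, x k * (f x * f x * (x k / (1 + ε * x k ^ 2))) ∂(gaussianPi n)
      ≤ 4 * ∫ x, pd f k x ^ 2 ∂(gaussianPi n) + 2 * ∫ x, f x ^ 2 ∂(gaussianPi n) := by
  have hfd : Differentiable ℝ f := hf.differentiable one_ne_zero
  have hpos : ∀ t : ℝ, 0 < 1 + ε * t ^ 2 := fun t => by positivity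
  have hqc : Continuous fun x : Fin n → ℝ => x k / (1 + ε * x k ^ 2) :=
    (continuous_div_one_add_mul_sq hε).comp (continuous_apply k)
  have hqd : Differentiable ℝ fun x : Fin n → ℝ => x k / (1 + ε * x k ^ 2) := fun x =>
    (hasFDerivAt_comp_apply k x (hasDerivAt_div_one_add_mul_sq hε (x k))).differentiableAt
  have hq'c : Continuous fun x : Fin n → ℝ => (1 - ε * x k ^ 2) / (1 + ε * x k ^ 2) ^ 2 :=
    Continuous.div (by fun_prop) (by fun_prop) fun x => (pow_pos (hpos _) 2).ne'
  have hqb : ∀ t : ℝ, ‖t / (1 + ε * t ^ 2)‖ ≤ 1 / ε := fun t => by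
    rw [Real.norm_eq_abs, abs_div, abs_of_pos (hpos t), div_le_div_iff₀ (hpos t) hε]
    nlinarith [sq_nonneg (|t| - 1), sq_abs t, abs_nonneg t]
  have hq'b : ∀ t : ℝ, ‖(1 - ε * t ^ 2) / (1 + ε * t ^ 2) ^ 2‖ ≤ 1 := fun t => by
    have : 0 ≤ ε * t ^ 2 := by positivity
    rw [Real.norm_eq_abs, abs_le, le_div_iff₀ (pow_pos (hpos t) 2),
      div_le_iff₀ (pow_pos (hpos t) 2)]
    constructor <;> nlinarith
  have hxqb : ∀ t : ℝ, ‖t * (t / (1 + ε * t ^ 2))‖ ≤ 1 / ε := fun t => by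
    have : t * (t / (1 + ε * t ^ 2)) = t ^ 2 / (1 + ε * t ^ 2) := by ring
    rw [this, Real.norm_eq_abs, abs_of_nonneg (by positivity), div_le_div_iff₀ (hpos t) hε]
    nlinarith
  have hff : Integrable (fun x => f x * f x) (gaussianPi n) := hf2.integrable_mul hf2
  have hff' : Integrable (fun x => pd f k x * f x) (gaussianPi n) := hf2'.integrable_mul hf2
  have hpd : ∀ x, pd (fun y => f y * f y * (y k / (1 + ε * y k ^ 2))) k x
      = 2 * (pd f k x * f x * (x k / (1 + ε * x k ^ 2)))
        + f x * f x * ((1 - ε * x k ^ 2) / (1 + ε * x k ^ 2) ^ 2) := by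
    intro x
    rw [pd_mul (hfd.fun_mul hfd) hqd, pd_mul hfd hfd,
      pd_comp_apply k k x (hasDerivAt_div_one_add_mul_sq hε (x k)), if_pos rfl]
    ring
  have hF : Integrable (fun x => f x * f x * (x k / (1 + ε * x k ^ 2))) (gaussianPi n) :=
    hff.mul_bdd hqc.aestronglyMeasurable (ae_of_all _ fun x => hqb (x k))
  have hxF : Integrable (fun x => x k * (f x * f x * (x k / (1 + ε * x k ^ 2))))
      (gaussianPi n) := by
    have := hff.mul_bdd (g := fun x => x k * (x k / (1 + ε * x k ^ 2)))
      ((continuous_apply k).mul hqc).aestronglyMeasurable (ae_of_all _ fun x => hxqb (x k))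
    refine this.congr (ae_of_all _ fun x => ?_)
    ring
  have hF' : Integrable (pd (fun y => f y * f y * (y k / (1 + ε * y k ^ 2))) k)
      (gaussianPi n) := by
    rw [funext hpd]
    exact ((hff'.mul_bdd hqc.aestronglyMeasurable (ae_of_all _ fun x => hqb (x k))).const_mul
      2).add (hff.mul_bdd hq'c.aestronglyMeasurable (ae_of_all _ fun x => hq'b (x k)))
  refine ⟨hxF, ?_⟩
  have hibp := integral_mul_gaussianPi_eq_integral_pd k ((hfd.fun_mul hfd).fun_mul hqd) hF hF' hxF
  have hI : Integrable (fun x => 2 * pd f k x ^ 2 + f x ^ 2) (gaussianPi n) :=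
    (hf2'.integrable_sq.const_mul 2).add hf2.integrable_sq
  have hle : ∫ x, pd (fun y => f y * f y * (y k / (1 + ε * y k ^ 2))) k x ∂(gaussianPi n)
      ≤ ∫ x, (1 / 2 * (x k * (f x * f x * (x k / (1 + ε * x k ^ 2))))
        + (2 * pd f k x ^ 2 + f x ^ 2)) ∂(gaussianPi n) := by
    refine integral_mono hF' ((hxF.const_mul _).add hI) fun x => ?_
    have hw := hpos (x k)
    have h1 : f x * f x * ((1 - ε * x k ^ 2) / (1 + ε * x k ^ 2) ^ 2) ≤ f x ^ 2 := by
      have := (le_abs_self _).trans (hq'b (x k))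
      nlinarith [mul_self_nonneg (f x)]
    have h2 : (f x * (x k / (1 + ε * x k ^ 2))) ^ 2
        ≤ x k * (f x * f x * (x k / (1 + ε * x k ^ 2))) := by
      have h3 : x k * (f x * f x * (x k / (1 + ε * x k ^ 2)))
          = (f x * (x k / (1 + ε * x k ^ 2))) ^ 2 * (1 + ε * x k ^ 2) := by
        field_simp
      rw [h3]
      have : 0 ≤ ε * x k ^ 2 := by positivity
      nlinarith [sq_nonneg (f x * (x k / (1 + ε * x k ^ 2)))]
    simp only [hpd]
    nlinarith [sq_nonneg (2 * pd f k x - f x * (x k / (1 + ε * x k ^ 2)))]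
  rw [← hibp, integral_add (hxF.const_mul _) hI,
    integral_add (hf2'.integrable_sq.const_mul 2) hf2.integrable_sq, integral_const_mul,
    integral_const_mul] at hle
  linarith

/-- If `f` and `∂f/∂x_k` are square-integrable, then so is `x_k f`. -/
lemma memLp_apply_mul {n : ℕ} {f : (Fin n → ℝ) → ℝ} (k : Fin n)
    (hf : ContDiff ℝ 1 f) (hf2 : MemLp f 2 (gaussianPi n))
    (hf2' : MemLp (pd f k) 2 (gaussianPi n)) :
    MemLp (fun x => x k * f x) 2 (gaussianPi n) := by
  have hc : Continuous fun x : Fin n → ℝ => x k * f x := (continuous_apply k).mul hf.continuous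
  rw [memLp_two_iff_integrable_sq hc.aestronglyMeasurable]
  refine ⟨(hc.pow 2).aestronglyMeasurable, ?_⟩
  set C : ℝ := 4 * ∫ x, pd f k x ^ 2 ∂(gaussianPi n) + 2 * ∫ x, f x ^ 2 ∂(gaussianPi n)
  let G : ℕ → (Fin n → ℝ) → ℝ := fun m x =>
    x k * (f x * f x * (x k / (1 + 1 / ((m : ℝ) + 1) * x k ^ 2)))
  have hbound : ∀ m, Integrable (G m) (gaussianPi n) ∧ ∫ x, G m x ∂(gaussianPi n) ≤ C :=
    fun m => integral_truncated_sq_mul_sq_le k hf hf2 hf2' Nat.one_div_pos_of_nat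
      (by rw [div_le_one (by positivity)]; linarith [(Nat.cast_nonneg m : (0 : ℝ) ≤ m)])
  have hnonneg : ∀ m x, 0 ≤ G m x := fun m x => by
    have : G m x = (x k * f x) ^ 2 / (1 + 1 / ((m : ℝ) + 1) * x k ^ 2) := by
      simp only [G]
      ring
    rw [this]
    positivity
  have hlim : ∀ x, Filter.Tendsto (fun m => G m x) Filter.atTop (nhds ((x k * f x) ^ 2)) := by
    intro x
    have h1 : Filter.Tendsto (fun m : ℕ => 1 + 1 / ((m : ℝ) + 1) * x k ^ 2) Filter.atTop
        (nhds (1 + 0 * x k ^ 2)) :=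
      (tendsto_one_div_add_atTop_nhds_zero_nat.mul_const _).const_add 1
    have h2 := (((tendsto_const_nhds (x := x k)).div h1 (by simp)).const_mul
      (f x * f x)).const_mul (x k)
    have h3 : (x k * f x) ^ 2 = x k * (f x * f x * (x k / (1 + 0 * x k ^ 2))) := by
      rw [zero_mul, add_zero, div_one]
      ring
    rw [h3]
    exact h2
  calc ∫⁻ x, ‖(x k * f x) ^ 2‖ₑ ∂(gaussianPi n)
      = ∫⁻ x, Filter.liminf (fun m => ‖G m x‖ₑ) Filter.atTop ∂(gaussianPi n) :=
        lintegral_congr fun x => (hlim x).enorm.liminf_eq.symm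
    _ ≤ Filter.liminf (fun m => ∫⁻ x, ‖G m x‖ₑ ∂(gaussianPi n)) Filter.atTop :=
        lintegral_liminf_le' fun m => (hbound m).1.aestronglyMeasurable.enorm
    _ ≤ ENNReal.ofReal C := by
        refine Filter.liminf_le_of_frequently_le' (Filter.Frequently.of_forall fun m => ?_)
        rw [← ofReal_integral_norm_eq_lintegral_enorm (hbound m).1]
        refine ENNReal.ofReal_le_ofReal ?_
        simp_rw [Real.norm_of_nonneg (hnonneg m _)]
        exact (hbound m).2
    _ < ⊤ := ENNReal.ofReal_lt_top

/-- The operator `u ↦ x_k u - ∂u/∂x_k` is the adjoint of `∂/∂x_k` in `L²` of the Gaussian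
measure. -/
lemma integral_apply_mul_sub_pd_mul {n : ℕ} {u v : (Fin n → ℝ) → ℝ} (k : Fin n)
    (hu : ContDiff ℝ 1 u) (hv : ContDiff ℝ 1 v)
    (hu2 : MemLp u 2 (gaussianPi n)) (hu2' : MemLp (pd u k) 2 (gaussianPi n))
    (hv2 : MemLp v 2 (gaussianPi n)) (hv2' : MemLp (pd v k) 2 (gaussianPi n)) :
    ∫ x, (x k * u x - pd u k x) * v x ∂(gaussianPi n)
      = ∫ x, u x * pd v k x ∂(gaussianPi n) := by
  have hud := hu.differentiable one_ne_zero
  have hvd := hv.differentiable one_ne_zero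
  have h1 : Integrable (fun x => pd u k x * v x) (gaussianPi n) := hu2'.integrable_mul hv2
  have h2 : Integrable (fun x => u x * pd v k x) (gaussianPi n) := hu2.integrable_mul hv2'
  have h3 : Integrable (fun x => x k * (u x * v x)) (gaussianPi n) := by
    simpa only [mul_assoc, Pi.mul_def] using (memLp_apply_mul k hu hu2 hu2').integrable_mul hv2
  have hpd : pd (fun x => u x * v x) k = fun x => pd u k x * v x + u x * pd v k x :=
    funext fun x => pd_mul hud hvd k x
  have hibp := integral_mul_gaussianPi_eq_integral_pd k (hud.fun_mul hvd)
    (hu2.integrable_mul hv2) (by rw [hpd]; exact h1.add h2) h3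
  rw [hpd, integral_add h1 h2] at hibp
  simp_rw [sub_mul, mul_assoc]
  rw [integral_sub h3 h1, hibp]
  ring

lemma integral_apply_mul_sub_pd_mul_apply_mul_sub_pd {n : ℕ} {a b : (Fin n → ℝ) → ℝ}
    (j k : Fin n) (ha : ContDiff ℝ 1 a) (hb : ContDiff ℝ 2 b)
    (ha2 : MemLp a 2 (gaussianPi n)) (ha2' : ∀ i, MemLp (pd a i) 2 (gaussianPi n))
    (hb2 : MemLp b 2 (gaussianPi n)) (hb2' : ∀ i, MemLp (pd b i) 2 (gaussianPi n))
    (hb2'' : ∀ i l, MemLp (pd (pd b i) l) 2 (gaussianPi n)) :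
    ∫ x, (x j * a x - pd a j x) * (x k * b x - pd b k x) ∂(gaussianPi n)
      = (if k = j then ∫ x, a x * b x ∂(gaussianPi n) else 0)
        + ∫ x, pd a k x * pd b j x ∂(gaussianPi n) := by
  have hb1 : ContDiff ℝ 1 b := hb.of_le (by norm_num)
  have hbd := hb1.differentiable one_ne_zero
  have hbk := contDiff_pd hb k
  have hbj := contDiff_pd hb j
  have hxk : Differentiable ℝ fun x : Fin n → ℝ => x k := differentiable_apply k
  have hpd : pd (fun x => x k * b x - pd b k x) j
      = fun x => (if k = j then b x else 0) + (x k * pd b j x - pd (pd b j) k x) := by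
    funext x
    rw [pd_sub (hxk.fun_mul hbd) (hbk.differentiable one_ne_zero), pd_mul hxk hbd,
      pd_comp_apply k j x (hasDerivAt_id' (x k)), pd_pd_comm hb k j]
    split_ifs <;> ring
  have hδ : MemLp (fun x => if k = j then b x else 0) 2 (gaussianPi n) := by
    split_ifs
    · exact hb2
    · exact MemLp.zero'
  have hG : MemLp (fun x => x k * pd b j x - pd (pd b j) k x) 2 (gaussianPi n) :=
    (memLp_apply_mul k hbj (hb2' j) (hb2'' j k)).sub (hb2'' j k)
  rw [integral_apply_mul_sub_pd_mul j ha (v := fun x => x k * b x - pd b k x)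
    (((contDiff_apply ℝ ℝ k).mul hb1).sub hbk) ha2 (ha2' j)
    ((memLp_apply_mul k hb1 hb2 (hb2' k)).sub (hb2' k)) (by rw [hpd]; exact hδ.add hG), hpd]
  simp_rw [mul_add]
  refine (integral_add (ha2.integrable_mul hδ) (ha2.integrable_mul hG)).trans ?_
  simp only [Pi.mul_apply]
  congr 1
  · split_ifs <;> simp
  · have := integral_apply_mul_sub_pd_mul k hbj ha (hb2' j) (hb2'' j k) ha2 (ha2' k)
    simp_rw [mul_comm (a _), this, mul_comm (pd b j _)]

/-- Lemma 1.3 (the approximation lemma). -/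
theorem approximation_lemma (n : ℕ) (h : Fin n → (Fin n → ℝ) → ℝ)
    (hsmooth : ∀ j, ContDiff ℝ 2 (h j))
    (hL2 : ∀ j, Integrable (fun x => h j x ^ 2)
      (Measure.pi fun _ : Fin n => gaussianReal 0 1))
    (hL2' : ∀ j k, Integrable (fun x => pd (h j) k x ^ 2)
      (Measure.pi fun _ : Fin n => gaussianReal 0 1))
    (hL2'' : ∀ j k l, Integrable (fun x => pd (pd (h j) k) l x ^ 2)
      (Measure.pi fun _ : Fin n => gaussianReal 0 1)) :
    ∫ x, (∑ j, x j * h j x - ∑ j, pd (h j) j x) ^ 2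
        ∂(Measure.pi fun _ : Fin n => gaussianReal 0 1)
      = ∑ j, ∫ x, h j x ^ 2 ∂(Measure.pi fun _ : Fin n => gaussianReal 0 1)
        + ∑ j, ∑ k, ∫ x, pd (h j) k x * pd (h k) j x
            ∂(Measure.pi fun _ : Fin n => gaussianReal 0 1) := by
  have hs1 : ∀ j, ContDiff ℝ 1 (h j) := fun j => (hsmooth j).of_le (by norm_num)
  have m0 : ∀ j, MemLp (h j) 2 (gaussianPi n) := fun j =>
    (memLp_two_iff_integrable_sq (hs1 j).continuous.aestronglyMeasurable).2 (hL2 j)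
  have m1 : ∀ j k, MemLp (pd (h j) k) 2 (gaussianPi n) := fun j k =>
    (memLp_two_iff_integrable_sq (continuous_pd (hs1 j) k).aestronglyMeasurable).2 (hL2' j k)
  have m2 : ∀ j k l, MemLp (pd (pd (h j) k) l) 2 (gaussianPi n) := fun j k l =>
    (memLp_two_iff_integrable_sq
      (continuous_pd (contDiff_pd (hsmooth j) k) l).aestronglyMeasurable).2 (hL2'' j k l)
  have hD : ∀ j, MemLp (fun x => x j * h j x - pd (h j) j x) 2 (gaussianPi n) := fun j =>
    (memLp_apply_mul j (hs1 j) (m0 j) (m1 j j)).sub (m1 j j)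
  have hDD : ∀ j k, Integrable (fun x => (x j * h j x - pd (h j) j x)
      * (x k * h k x - pd (h k) k x)) (gaussianPi n) := fun j k => (hD j).integrable_mul (hD k)
  simp_rw [← Finset.sum_sub_distrib, sq (∑ j, _), Finset.sum_mul_sum]
  rw [integral_finsetSum _ fun j _ => integrable_finsetSum _ fun k _ => hDD j k,
    ← Finset.sum_add_distrib]
  refine Finset.sum_congr rfl fun j _ => ?_
  rw [integral_finsetSum _ fun k _ => hDD j k]
  simp_rw [fun k => integral_apply_mul_sub_pd_mul_apply_mul_sub_pd j k (hs1 j) (hsmooth k) (m0 j)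
    (m1 j) (m0 k) (m1 k) (m2 k)]
  rw [Finset.sum_add_distrib, Finset.sum_ite_eq' Finset.univ j, if_pos (Finset.mem_univ j)]
  simp_rw [sq]

end SK
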